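/- (Putinar, moment side) Let Q(g) be Archimedean with Ω = {x : g_j(x) ≥ 0, j=1,...,m}. A real sequence y = (y_α)_{α∈ℕⁿ} has a representing Borel measure on Ω if and only if L_y(f² gⱼ) ≥ 0 for all polynomials f and all j = 0,...,m (with g₀ ≡ 1). -/

import Mathlib

open MvPolynomial MeasureTheory

/-- A polynomial is a sum of squares. -/
def IsSOS {n : ℕ} (p : MvPolynomial (Fin n) ℝ) : Prop :=
  ∃ (k : ℕ) (q : Fin k → MvPolynomial (Fin n) ℝ), p = ∑ i, q i ^ 2

/-- Membership in the quadratic module Q(g₁,...,g_m). -/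
def InQuadraticModule {n m : ℕ} (g : Fin m → MvPolynomial (Fin n) ℝ)
    (p : MvPolynomial (Fin n) ℝ) : Prop :=
  ∃ (σ₀ : MvPolynomial (Fin n) ℝ) (σ : Fin m → MvPolynomial (Fin n) ℝ),
    IsSOS σ₀ ∧ (∀ j, IsSOS (σ j)) ∧ p = σ₀ + ∑ j, σ j * g j

/-- The Riesz functional of a sequence `y`. -/
noncomputable def Riesz {n : ℕ} (y : (Fin n →₀ ℕ) → ℝ)
    (p : MvPolynomial (Fin n) ℝ) : ℝ :=
  ∑ α ∈ p.support, MvPolynomial.coeff α p * y α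

open CompactlySupported

/-- Functionals nonnegative on the quadratic module. -/
def PosFun {n m : ℕ} (g : Fin m → MvPolynomial (Fin n) ℝ)
    (l : MvPolynomial (Fin n) ℝ →ₗ[ℝ] ℝ) : Prop :=
  (∀ f, 0 ≤ l (f ^ 2)) ∧ ∀ f j, 0 ≤ l (f ^ 2 * g j)

/-- Polynomials on which every such functional is nonnegative. -/
def Dom {n m : ℕ} (g : Fin m → MvPolynomial (Fin n) ℝ) (p : MvPolynomial (Fin n) ℝ) : Prop :=
  ∀ l, PosFun g l → 0 ≤ l p

/-- The functional `p ↦ l (q * p)`. -/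
noncomputable def mulF {n : ℕ} (q : MvPolynomial (Fin n) ℝ)
    (l : MvPolynomial (Fin n) ℝ →ₗ[ℝ] ℝ) : MvPolynomial (Fin n) ℝ →ₗ[ℝ] ℝ :=
  l.comp (LinearMap.mulLeft ℝ q)

lemma mulF_apply {n : ℕ} (q p : MvPolynomial (Fin n) ℝ)
    (l : MvPolynomial (Fin n) ℝ →ₗ[ℝ] ℝ) : mulF q l p = l (q * p) := rfl

section
variable {n m : ℕ} {g : Fin m → MvPolynomial (Fin n) ℝ}

lemma PosFun.mul_sq {l : MvPolynomial (Fin n) ℝ →ₗ[ℝ] ℝ} (h : PosFun g l)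
    (s : MvPolynomial (Fin n) ℝ) : PosFun g (mulF (s ^ 2) l) := by
  refine ⟨fun f => ?_, fun f j => ?_⟩
  · rw [mulF_apply, ← mul_pow]; exact h.1 _
  · rw [mulF_apply, ← mul_assoc, ← mul_pow]; exact h.2 _ _

lemma map_C_mul' (l : MvPolynomial (Fin n) ℝ →ₗ[ℝ] ℝ) (c : ℝ) (p : MvPolynomial (Fin n) ℝ) :
    l (C c * p) = c * l p := by
  rw [← smul_eq_C_mul, map_smul, smul_eq_mul]

lemma map_C' (l : MvPolynomial (Fin n) ℝ →ₗ[ℝ] ℝ) (c : ℝ) : l (C c) = c * l 1 := by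
  rw [← map_C_mul', mul_one]

lemma Dom.sq (f : MvPolynomial (Fin n) ℝ) : Dom g (f ^ 2) := fun _ h => h.1 f

lemma Dom.add {p q : MvPolynomial (Fin n) ℝ} (hp : Dom g p) (hq : Dom g q) : Dom g (p + q) :=
  fun l h => by rw [map_add]; exact add_nonneg (hp l h) (hq l h)

lemma Dom.sq_mul {p : MvPolynomial (Fin n) ℝ} (s : MvPolynomial (Fin n) ℝ) (hp : Dom g p) :
    Dom g (s ^ 2 * p) := fun _ h => hp _ (h.mul_sq s)

lemma Dom.C_mul {p : MvPolynomial (Fin n) ℝ} {c : ℝ} (hc : 0 ≤ c) (hp : Dom g p) :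
    Dom g (C c * p) := fun l h => by rw [map_C_mul']; exact mul_nonneg hc (hp l h)

lemma Dom.sum {ι : Type*} (s : Finset ι) (f : ι → MvPolynomial (Fin n) ℝ)
    (h : ∀ i ∈ s, Dom g (f i)) : Dom g (∑ i ∈ s, f i) := fun l hl => by
  rw [map_sum]; exact Finset.sum_nonneg fun i hi => h i hi l hl

lemma Dom.of_mem {p : MvPolynomial (Fin n) ℝ} (hp : InQuadraticModule g p) : Dom g p := by
  obtain ⟨σ₀, σ, ⟨k, q, rfl⟩, hσ, rfl⟩ := hp
  refine (Dom.sum _ _ fun i _ => Dom.sq _).add (Dom.sum _ _ fun j _ => ?_)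
  obtain ⟨k, q, h⟩ := hσ j
  rw [h, Finset.sum_mul]
  exact Dom.sum _ _ fun i _ l hl => hl.2 _ _

lemma bdd_sq {M : ℝ} (hM0 : 0 < M) (hM : Dom g (C M - ∑ i : Fin n, X i ^ 2))
    (p : MvPolynomial (Fin n) ℝ) : ∃ N : ℝ, 0 ≤ N ∧ Dom g (C N - p ^ 2) := by
  induction p using MvPolynomial.induction_on with
  | C a => exact ⟨a ^ 2, sq_nonneg a, by
      rw [map_pow, sub_self]; intro l _; simp⟩
  | add p q hp hq =>
    obtain ⟨N, hN0, hN⟩ := hp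
    obtain ⟨N', hN0', hN'⟩ := hq
    refine ⟨2 * N + 2 * N', by positivity, ?_⟩
    have := ((Dom.C_mul (c := 2) (by norm_num) hN).add
      (Dom.C_mul (c := 2) (by norm_num) hN')).add (Dom.sq (p - q))
    convert this using 1
    have h2 : (C 2 : MvPolynomial (Fin n) ℝ) = 2 := map_ofNat C 2
    simp only [map_add, map_mul, h2]
    ring
  | mul_X p i hp =>
    obtain ⟨N, hN0, hN⟩ := hp
    have hX : Dom g (C M - X i ^ 2) := by
      have := hM.add (Dom.sum (Finset.univ.erase i) (fun i => (X i : MvPolynomial (Fin n) ℝ) ^ 2)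
        fun j _ => Dom.sq _)
      convert this using 1
      rw [← Finset.add_sum_erase _ _ (Finset.mem_univ i)]
      ring
    refine ⟨N * M, by positivity, ?_⟩
    have := (Dom.C_mul hM0.le hN).add (Dom.sq_mul p hX)
    convert this using 1
    simp only [map_mul]
    ring

lemma bdd_lin {N : ℝ} {q : MvPolynomial (Fin n) ℝ} (h : Dom g (C N - q ^ 2)) :
    Dom g (C ((N + 1) / 2) - q) := by
  have := Dom.C_mul (c := 1 / 2) (by norm_num) (h.add (Dom.sq (q - 1)))
  convert this using 1
  have h2 : (C (1 / 2) : MvPolynomial (Fin n) ℝ) * 2 = 1 := by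
    rw [← map_ofNat (C : ℝ →+* MvPolynomial (Fin n) ℝ) 2, ← map_mul]; norm_num
  rw [show (N + 1) / 2 = (1 / 2) * (N + 1) by ring]
  simp only [map_mul, map_add, C_1]
  linear_combination q * h2

lemma cs_real {a b c : ℝ} (h : ∀ t : ℝ, 0 ≤ a + 2 * t * b + t ^ 2 * c) : b ^ 2 ≤ a * c := by
  have := discrim_le_zero (a := c) (b := 2 * b) (c := a) fun t => by nlinarith [h t]
  rw [discrim] at this
  nlinarith

lemma seq_lemma {a : ℕ → ℝ} {N K : ℝ} (hN : 0 < N) (h0 : ∀ k, 0 ≤ a k)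
    (hcs : ∀ k, a (k + 1) ^ 2 ≤ a k * a (k + 2)) (hb : ∀ k, a k ≤ K * N ^ k) :
    a 1 ≤ N * a 0 := by
  by_contra! hlt
  have ha0 : 0 < a 0 := by
    rcases (h0 0).lt_or_eq with h | h
    · exact h
    · have h1 := hcs 0
      rw [← h] at h1 hlt
      simp only [zero_add, zero_mul, mul_zero] at h1 hlt
      nlinarith
  set r := a 1 / a 0 with hr
  have hrN : N < r := by rw [hr, lt_div_iff₀ ha0]; exact hlt
  have hr0 : 0 < r := hN.trans hrN
  have hstep : ∀ k, 0 < a k ∧ r * a k ≤ a (k + 1) := by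
    intro k
    induction k with
    | zero => exact ⟨ha0, by rw [hr, div_mul_cancel₀ _ ha0.ne']⟩
    | succ k ih =>
      have hpos : 0 < a (k + 1) := lt_of_lt_of_le (mul_pos hr0 ih.1) ih.2
      refine ⟨hpos, ?_⟩
      have h1 := hcs k
      have h2 : a k * (r * a (k + 1)) ≤ a k * a (k + 2) := by nlinarith [ih.2]
      exact le_of_mul_le_mul_left h2 ih.1
  have hgrow : ∀ k, r ^ k * a 0 ≤ a k := by
    intro k
    induction k with
    | zero => simp
    | succ k ih =>
      calc r ^ (k + 1) * a 0 = r * (r ^ k * a 0) := by ring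
        _ ≤ r * a k := by gcongr
        _ ≤ _ := (hstep k).2
  obtain ⟨k, hk⟩ := pow_unbounded_of_one_lt (K / a 0) ((one_lt_div hN).2 hrN)
  rw [div_pow, div_lt_div_iff₀ ha0 (by positivity)] at hk
  linarith [hgrow k, hb k]

lemma PosFun.mul_bdd_sub {l : MvPolynomial (Fin n) ℝ →ₗ[ℝ] ℝ}
    (hB : ∀ p : MvPolynomial (Fin n) ℝ, ∃ N : ℝ, 0 ≤ N ∧ Dom g (C N - p ^ 2))
    (h : PosFun g l) {N : ℝ} (hN : 0 < N) {f : MvPolynomial (Fin n) ℝ}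
    (hf : Dom g (C N - f ^ 2)) : PosFun g (mulF (C N - f ^ 2) l) := by
  have hpow : ∀ k, l (f ^ (2 * k)) ≤ N ^ k * l 1 := by
    intro k
    induction k with
    | zero => simp
    | succ k ih =>
      have h1 := hf _ (h.mul_sq (f ^ k))
      rw [mulF_apply, mul_sub, map_sub, mul_comm _ (C N), map_C_mul',
        show (f ^ k) ^ 2 * f ^ 2 = f ^ (2 * (k + 1)) by ring,
        show (f ^ k) ^ 2 = f ^ (2 * k) by ring] at h1
      calc l (f ^ (2 * (k + 1))) ≤ N * l (f ^ (2 * k)) := by linarith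
        _ ≤ N * (N ^ k * l 1) := by gcongr
        _ = _ := by ring
  have key : ∀ q : MvPolynomial (Fin n) ℝ, (∀ s, 0 ≤ l (s ^ 2 * q)) →
      0 ≤ l ((C N - f ^ 2) * q) := by
    intro q hq
    obtain ⟨N', hN0', hN'⟩ := hB q
    have hc := bdd_lin hN'
    set c := (N' + 1) / 2 with hcdef
    have hc0 : 0 ≤ c := by positivity
    have := seq_lemma (a := fun k => l (f ^ (2 * k) * q)) (N := N) (K := c * l 1) hN
      (fun k => by
        have := hq (f ^ k)
        rwa [show (f ^ k) ^ 2 = f ^ (2 * k) by ring] at this)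
      (fun k => by
        refine cs_real fun t => ?_
        have := hq (f ^ k + C t * f ^ (k + 2))
        rw [show (f ^ k + C t * f ^ (k + 2)) ^ 2 * q = f ^ (2 * k) * q
          + (C t * (f ^ (2 * (k + 1)) * q) + C t * (f ^ (2 * (k + 1)) * q))
          + C t * (C t * (f ^ (2 * (k + 2)) * q)) by ring] at this
        simp only [map_add, map_C_mul'] at this
        nlinarith)
      (fun k => by
        have h1 := hc _ (h.mul_sq (f ^ k))
        rw [mulF_apply, mul_sub, map_sub, mul_comm _ (C c), map_C_mul',
          show (f ^ k) ^ 2 = f ^ (2 * k) by ring] at h1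
        have := mul_le_mul_of_nonneg_left (hpow k) hc0
        show l (f ^ (2 * k) * q) ≤ c * l 1 * N ^ k
        nlinarith)
    rw [sub_mul, map_sub, map_C_mul']
    simpa using this
  refine ⟨fun s => key _ fun t => ?_, fun s j => key _ fun t => ?_⟩
  · rw [← mul_pow]; exact h.1 _
  · rw [← mul_assoc, ← mul_pow]; exact h.2 _ _

lemma abs_bound
    (hB : ∀ p : MvPolynomial (Fin n) ℝ, ∃ N : ℝ, 0 ≤ N ∧ Dom g (C N - p ^ 2))
    (p : MvPolynomial (Fin n) ℝ) : ∃ c : ℝ, ∀ l, PosFun g l → |l p| ≤ c * l 1 := by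
  obtain ⟨N, hN0, hN⟩ := hB p
  have h1 := bdd_lin hN
  have h2 := bdd_lin (q := -p) (by simpa using hN)
  refine ⟨(N + 1) / 2, fun l hl => ?_⟩
  have a1 := h1 l hl
  have a2 := h2 l hl
  rw [map_sub, map_C'] at a1 a2
  rw [map_neg] at a2
  rw [abs_le]
  constructor <;> linarith

/-- normalized states -/
def stateSet (g : Fin m → MvPolynomial (Fin n) ℝ) : Set (MvPolynomial (Fin n) ℝ → ℝ) :=
  {φ | ∃ l : MvPolynomial (Fin n) ℝ →ₗ[ℝ] ℝ, PosFun g l ∧ l 1 = 1 ∧ (l : _ → ℝ) = φ}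

lemma PosFun.smul {l : MvPolynomial (Fin n) ℝ →ₗ[ℝ] ℝ} (h : PosFun g l) {c : ℝ} (hc : 0 ≤ c) :
    PosFun g (c • l) :=
  ⟨fun f => mul_nonneg hc (h.1 f), fun f j => mul_nonneg hc (h.2 f j)⟩

lemma stateSet_convex : Convex ℝ (stateSet g) := by
  rintro _ ⟨l, hl, h1, rfl⟩ _ ⟨l', hl', h1', rfl⟩ a b ha hb hab
  refine ⟨a • l + b • l', ⟨fun f => ?_, fun f j => ?_⟩, ?_, ?_⟩
  · exact add_nonneg (mul_nonneg ha (hl.1 f)) (mul_nonneg hb (hl'.1 f))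
  · exact add_nonneg (mul_nonneg ha (hl.2 f j)) (mul_nonneg hb (hl'.2 f j))
  · simp [h1, h1', hab]
  · ext; simp

lemma stateSet_compact
    (hB : ∀ p : MvPolynomial (Fin n) ℝ, ∃ N : ℝ, 0 ≤ N ∧ Dom g (C N - p ^ 2)) :
    IsCompact (stateSet g) := by
  choose c hc using abs_bound hB
  have hK : IsCompact (Set.univ.pi fun p => Set.Icc (-c p) (c p)) :=
    isCompact_univ_pi fun p => isCompact_Icc
  refine hK.of_isClosed_subset ?_ ?_
  · have : stateSet g = {φ | (∀ p q, φ (p + q) = φ p + φ q) ∧ (∀ (r : ℝ) p, φ (r • p) = r * φ p) ∧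
        (∀ f, 0 ≤ φ (f ^ 2)) ∧ (∀ f j, 0 ≤ φ (f ^ 2 * g j)) ∧ φ 1 = 1} := by
      ext φ
      constructor
      · rintro ⟨l, hl, h1, rfl⟩
        exact ⟨fun p q => map_add _ _ _, fun r p => by simp, hl.1, hl.2, h1⟩
      · rintro ⟨ha, hs, hf, hg, h1⟩
        exact ⟨{ toFun := φ, map_add' := ha, map_smul' := hs }, ⟨hf, hg⟩, h1, rfl⟩
    rw [this]
    simp only [Set.ofPred_and, Set.ofPred_forall]
    refine IsClosed.inter ?_ (IsClosed.inter ?_ (IsClosed.inter ?_ (IsClosed.inter ?_ ?_)))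
    · exact isClosed_iInter fun p => isClosed_iInter fun q => isClosed_eq (by fun_prop) (by fun_prop)
    · exact isClosed_iInter fun p => isClosed_iInter fun q => isClosed_eq (by fun_prop) (by fun_prop)
    · exact isClosed_iInter fun p => isClosed_le (by fun_prop) (by fun_prop)
    · exact isClosed_iInter fun p => isClosed_iInter fun q => isClosed_le (by fun_prop) (by fun_prop)
    · exact isClosed_eq (by fun_prop) (by fun_prop)
  · rintro _ ⟨l, hl, h1, rfl⟩ p _
    have := hc p l hl
    rw [h1, mul_one, abs_le] at this
    exact this

lemma extreme_eval
    (hB : ∀ p : MvPolynomial (Fin n) ℝ, ∃ N : ℝ, 0 ≤ N ∧ Dom g (C N - p ^ 2))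
    {φ : MvPolynomial (Fin n) ℝ → ℝ} (hφ : φ ∈ (stateSet g).extremePoints ℝ) :
    ∃ x : Fin n → ℝ, (∀ j, 0 ≤ eval x (g j)) ∧ ∀ p, φ p = eval x p := by
  rw [mem_extremePoints_iff_left] at hφ
  obtain ⟨⟨l, hl, h1, rfl⟩, hext⟩ := hφ
  have hsq : ∀ f p, l (f ^ 2 * p) = l (f ^ 2) * l p := by
    intro f p
    obtain ⟨N, hN0, hN⟩ := hB f
    have hN1 : Dom g (C (N + 1) - f ^ 2) := by
      have := hN.add (Dom.sq 1)
      convert this using 1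
      simp only [map_add, C_1]; ring
    have hle := hN l hl
    rw [map_sub, map_C', h1] at hle
    have hP1 := hl.mul_sq f
    have hP2 := hl.mul_bdd_sub hB (by positivity) hN1
    rcases (hl.1 f).lt_or_eq with hpos | hz
    · have hd : 0 < N + 1 - l (f ^ 2) := by linarith
      have := hext (((l (f ^ 2))⁻¹ • mulF (f ^ 2) l : MvPolynomial (Fin n) ℝ →ₗ[ℝ] ℝ))
        ⟨_, hP1.smul (by positivity), by
          simp [mulF_apply, hpos.ne'], rfl⟩
        (((N + 1 - l (f ^ 2))⁻¹ • mulF (C (N + 1) - f ^ 2) l :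
          MvPolynomial (Fin n) ℝ →ₗ[ℝ] ℝ))
        ⟨_, hP2.smul (by positivity), by
          rw [LinearMap.smul_apply, mulF_apply, mul_one, map_sub, map_C', h1, mul_one, smul_eq_mul,
            inv_mul_cancel₀ hd.ne'], rfl⟩
        ⟨l (f ^ 2) / (N + 1), (N + 1 - l (f ^ 2)) / (N + 1), by positivity, by positivity,
          by field_simp; ring, by
            ext p
            simp only [Pi.add_apply, Pi.smul_apply, LinearMap.smul_apply, mulF_apply, smul_eq_mul,
              sub_mul, map_sub, map_C_mul']
            have hN1' : N + 1 ≠ 0 := by positivity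
            field_simp
            ring⟩
      have := congrFun this p
      simp only [LinearMap.smul_apply, mulF_apply, smul_eq_mul] at this
      rw [← this]
      field_simp
    · obtain ⟨c, hc⟩ := abs_bound hB p
      have := hc _ hP1
      rw [mulF_apply, mulF_apply, mul_one, ← hz, mul_zero] at this
      rw [← hz, zero_mul]
      exact abs_nonpos_iff.1 this
  have hmul : ∀ p q, l (p * q) = l p * l q := by
    intro p q
    have e1 := hsq (p + 1) q
    have e2 := hsq (p - 1) q
    have e3 : l (C 4 * (p * q)) = l (C 4 * p) * l q := by
      have h4 : (C 4 : MvPolynomial (Fin n) ℝ) = 4 := map_ofNat C 4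
      rw [show C 4 * (p * q) = (p + 1) ^ 2 * q - (p - 1) ^ 2 * q by rw [h4]; ring,
        show C 4 * p = (p + 1) ^ 2 - (p - 1) ^ 2 by rw [h4]; ring, map_sub, map_sub, e1, e2]
      ring
    rw [map_C_mul', map_C_mul'] at e3
    linarith
  have hev : ∀ p, l p = eval (fun i => l (X i)) p := by
    intro p
    induction p using MvPolynomial.induction_on with
    | C a => rw [map_C', h1, mul_one, eval_C]
    | add p q hp hq => rw [map_add, map_add, hp, hq]
    | mul_X p i hp => rw [hmul, hp, map_mul, eval_X]
  refine ⟨_, fun j => ?_, hev⟩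
  rw [← hev]
  have := hl.2 1 j
  simpa using this

lemma nonneg_of_nonneg
    (hB : ∀ p : MvPolynomial (Fin n) ℝ, ∃ N : ℝ, 0 ≤ N ∧ Dom g (C N - p ^ 2))
    {l : MvPolynomial (Fin n) ℝ →ₗ[ℝ] ℝ} (hl : PosFun g l) (p : MvPolynomial (Fin n) ℝ)
    (hp : ∀ x, (∀ j, 0 ≤ eval x (g j)) → 0 ≤ eval x p) : 0 ≤ l p := by
  have h1 : 0 ≤ l 1 := by simpa using hl.1 1
  rcases h1.lt_or_eq with h1 | h1
  · have hmem : (((l 1)⁻¹ • l : MvPolynomial (Fin n) ℝ →ₗ[ℝ] ℝ) : MvPolynomial (Fin n) ℝ → ℝ)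
        ∈ stateSet g := ⟨_, hl.smul (by positivity), by simp [h1.ne'], rfl⟩
    have hsub : stateSet g ⊆ {φ | 0 ≤ φ p} := by
      rw [← closure_convexHull_extremePoints (stateSet_compact hB) stateSet_convex]
      refine closure_minimal (convexHull_min ?_ ?_) (isClosed_le (by fun_prop) (by fun_prop))
      · intro φ hφ
        obtain ⟨x, hx, he⟩ := extreme_eval hB hφ
        show 0 ≤ φ p
        rw [he]; exact hp x hx
      · intro φ h ψ h' a b ha hb _
        exact add_nonneg (mul_nonneg ha h) (mul_nonneg hb h')
    have := hsub hmem
    simp only [Set.mem_ofPred_eq, LinearMap.smul_apply, smul_eq_mul] at this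
    exact nonneg_of_mul_nonneg_right this (by positivity)
  · obtain ⟨c, hc⟩ := abs_bound hB p
    have := hc l hl
    rw [← h1, mul_zero] at this
    exact (abs_nonpos_iff.1 this).ge

lemma exists_measure {S : Set (Fin n → ℝ)} (hS : IsCompact S)
    (l : MvPolynomial (Fin n) ℝ →ₗ[ℝ] ℝ)
    (hl : ∀ p, (∀ x ∈ S, 0 ≤ eval x p) → 0 ≤ l p) :
    ∃ μ : Measure (Fin n → ℝ), μ Sᶜ = 0 ∧
      ∀ p, Integrable (fun x => eval x p) μ ∧ l p = ∫ x, eval x p ∂μ := by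
  have : CompactSpace S := isCompact_iff_compactSpace.1 hS
  let ev : MvPolynomial (Fin n) ℝ →ₗ[ℝ] C_c(S, ℝ) :=
    { toFun := fun p => CompactlySupportedContinuousMap.continuousMapEquiv
        ⟨fun x => eval x.1 p, (MvPolynomial.continuous_eval p).comp continuous_subtype_val⟩
      map_add' := fun p q => by ext; simp
      map_smul' := fun r p => by ext; simp }
  have hev : ∀ p (x : S), ev p x = eval x.1 p := fun p x => rfl
  have hker : ∀ p, ev p = 0 → l p = 0 := by
    intro p hp
    have hz : ∀ x ∈ S, eval x p = 0 := fun x hx => by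
      rw [← hev p ⟨x, hx⟩, hp]; rfl
    have a1 := hl p fun x hx => (hz x hx).ge
    have a2 := hl (-p) fun x hx => by rw [map_neg, hz x hx, neg_zero]
    rw [map_neg] at a2
    linarith
  obtain ⟨f0, hf0⟩ : ∃ f0 : C_c(S, ℝ) →ₗ[ℝ] ℝ, f0.comp ev = l := by
    have : l ∈ LinearMap.range ev.dualMap := by
      rw [LinearMap.range_dualMap_eq_dualAnnihilator_ker, Submodule.mem_dualAnnihilator]
      exact fun p hp => hker p hp
    exact this
  have hf0' : ∀ p, f0 (ev p) = l p := fun p => by rw [← hf0]; rfl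
  have : PosSMulMono ℝ C_c(S, ℝ) :=
    ⟨fun a ha f₁ f₂ h x => mul_le_mul_of_nonneg_left (h x) ha⟩
  obtain ⟨G, hG, hGpos⟩ := riesz_extension (PointedCone.positive ℝ C_c(S, ℝ))
    ⟨LinearMap.range ev, f0.domRestrict _⟩
    (by
      rintro ⟨_, p, rfl⟩ hp
      show 0 ≤ f0 (ev p)
      rw [hf0']
      exact hl p fun x hx => hp ⟨x, hx⟩)
    (by
      intro y
      obtain ⟨c, hc⟩ := (isCompact_range y.continuous).bddBelow
      refine ⟨⟨ev (C (-c)), _, rfl⟩, ?_⟩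
      intro x
      have : c ≤ y x := hc ⟨x, rfl⟩
      show 0 ≤ ev (C (-c)) x + y x
      rw [hev, eval_C]
      linarith)
  let Λ : C_c(S, ℝ) →ₚ[ℝ] ℝ := PositiveLinearMap.mk₀ G hGpos
  let ν := RealRMK.rieszMeasure Λ
  have : IsFiniteMeasure ν := inferInstance
  have hint : ∀ p, ∫ x : S, eval x.1 p ∂ν = l p := fun p => by
    have h1 := RealRMK.integral_rieszMeasure Λ (ev p)
    have h2 : Λ (ev p) = f0 (ev p) := hG ⟨ev p, p, rfl⟩
    rw [h2, hf0'] at h1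
    exact h1
  have hme : MeasurableEmbedding (Subtype.val : S → Fin n → ℝ) :=
    MeasurableEmbedding.subtype_coe hS.measurableSet
  refine ⟨ν.map Subtype.val, ?_, fun p => ⟨?_, ?_⟩⟩
  · rw [hme.map_apply]; simp
  · rw [hme.integrable_map_iff]
    have hc : Continuous ((fun x => eval x p) ∘ (Subtype.val : S → Fin n → ℝ)) :=
      (MvPolynomial.continuous_eval p).comp continuous_subtype_val
    exact hc.integrable_of_hasCompactSupport (HasCompactSupport.of_compactSpace _)
  · rw [hme.integral_map, hint]

end

/-- The Riesz functional as a linear map. -/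
noncomputable def RieszL {n : ℕ} (y : (Fin n →₀ ℕ) → ℝ) : MvPolynomial (Fin n) ℝ →ₗ[ℝ] ℝ :=
  (basisMonomials (Fin n) ℝ).constr ℝ y

lemma RieszL_monomial {n : ℕ} (y : (Fin n →₀ ℕ) → ℝ) (α : Fin n →₀ ℕ) :
    RieszL y (monomial α 1) = y α := by
  have := (basisMonomials (Fin n) ℝ).constr_basis ℝ y α
  simpa [RieszL] using this

lemma RieszL_eq {n : ℕ} (y : (Fin n →₀ ℕ) → ℝ) (p : MvPolynomial (Fin n) ℝ) :
    RieszL y p = Riesz y p := by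
  conv_lhs => rw [p.as_sum]
  rw [map_sum, Riesz]
  refine Finset.sum_congr rfl fun α _ => ?_
  rw [← RieszL_monomial y α, ← smul_eq_mul, ← map_smul, smul_monomial, smul_eq_mul, mul_one]

lemma eval_monomial_one {n : ℕ} (x : Fin n → ℝ) (α : Fin n →₀ ℕ) :
    eval x (monomial α (1 : ℝ)) = ∏ i, x i ^ α i := by
  rw [eval_monomial, one_mul, Finsupp.prod_fintype _ _ (fun i => pow_zero _)]

/-- Putinar's theorem, moment side: if the quadratic module is Archimedean,
a sequence `y` has a representing measure on `Ω` iff `L_y(f² gⱼ) ≥ 0`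
for all polynomials `f` and all `j = 0,…,m` (with `g₀ ≡ 1`). -/
theorem putinar_moment_side {n m : ℕ}
    (g : Fin m → MvPolynomial (Fin n) ℝ)
    (hArch : ∃ M : ℝ, 0 < M ∧
      InQuadraticModule g (MvPolynomial.C M - ∑ i : Fin n, MvPolynomial.X i ^ 2))
    (y : (Fin n →₀ ℕ) → ℝ) :
    (∃ μ : Measure (Fin n → ℝ),
        μ {x : Fin n → ℝ | ¬ ∀ j, 0 ≤ MvPolynomial.eval x (g j)} = 0 ∧
        ∀ α : Fin n →₀ ℕ,
          Integrable (fun x => ∏ i, x i ^ α i) μ ∧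
          y α = ∫ x, ∏ i, x i ^ α i ∂μ) ↔
    ((∀ f : MvPolynomial (Fin n) ℝ, 0 ≤ Riesz y (f ^ 2)) ∧
      ∀ (f : MvPolynomial (Fin n) ℝ) (j : Fin m), 0 ≤ Riesz y (f ^ 2 * g j)) := by
  obtain ⟨M, hM0, hM⟩ := hArch
  have hD := Dom.of_mem hM
  have hB := bdd_sq hM0 hD
  constructor
  · rintro ⟨μ, hμ, hy⟩
    have hR : ∀ p, Riesz y p = ∫ x, eval x p ∂μ := by
      intro p
      simp only [eval_eq', Riesz]
      rw [integral_finsetSum _ fun α _ => (hy α).1.const_mul _]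
      refine Finset.sum_congr rfl fun α _ => ?_
      rw [integral_const_mul, (hy α).2]
    refine ⟨fun f => ?_, fun f j => ?_⟩
    · rw [hR]
      refine integral_nonneg fun x => ?_
      simp only [map_pow]
      exact sq_nonneg _
    · rw [hR]
      refine integral_nonneg_of_ae ?_
      have hae : ∀ᵐ x ∂μ, ∀ j, 0 ≤ eval x (g j) := hμ
      filter_upwards [hae] with x hx
      simp only [map_mul, map_pow]
      exact mul_nonneg (sq_nonneg _) (hx j)
  · rintro ⟨h0, hj⟩
    have hl : PosFun g (RieszL y) :=
      ⟨fun f => by rw [RieszL_eq]; exact h0 f, fun f j => by rw [RieszL_eq]; exact hj f j⟩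
    have hcl : IsClosed {x : Fin n → ℝ | ∀ j, 0 ≤ eval x (g j)} := by
      simp only [Set.ofPred_forall]
      exact isClosed_iInter fun j => isClosed_le continuous_const (MvPolynomial.continuous_eval _)
    have hS : IsCompact {x : Fin n → ℝ | ∀ j, 0 ≤ eval x (g j)} := by
      have hK : IsCompact (Set.univ.pi fun _ : Fin n => Set.Icc (-(M + 1)) (M + 1)) :=
        isCompact_univ_pi fun p => isCompact_Icc
      refine hK.of_isClosed_subset hcl ?_
      intro x hx i _
      have hp := hD (MvPolynomial.aeval x : MvPolynomial (Fin n) ℝ →ₐ[ℝ] ℝ).toLinearMap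
        ⟨fun f => by
          simp only [AlgHom.toLinearMap_apply, map_pow]
          exact sq_nonneg _, fun f j => by
          simp only [AlgHom.toLinearMap_apply, map_pow, map_mul]
          exact mul_nonneg (sq_nonneg _) (hx j)⟩
      simp only [AlgHom.toLinearMap_apply, map_sub, map_sum, map_pow, aeval_X, aeval_C,
        Algebra.algebraMap_self, RingHom.id_apply] at hp
      have hi : x i ^ 2 ≤ ∑ i, x i ^ 2 :=
        Finset.single_le_sum (f := fun i => x i ^ 2) (fun i _ => sq_nonneg _) (Finset.mem_univ i)
      constructor <;> nlinarith
    obtain ⟨μ, hμ, h⟩ := exists_measure hS (RieszL y) fun p hp => nonneg_of_nonneg hB hl p hp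
    refine ⟨μ, hμ, fun α => ?_⟩
    have := h (monomial α 1)
    simp only [RieszL_monomial, eval_monomial_one] at this
    exact this
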